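/- arXiv:1603.05711 — 2 statements merged into one kernel-verified Lean document; each statement's English description precedes it below -/
import Mathlib

section
/- Let (A, m_A) be a commutative noetherian local ring and let M, N be finitely generated A-modules such that pd_A(M) = 1. If depth_A(N) ≤ 2, then depth_A(M) + depth_A(N) ≤ depth(A) + depth_A(Tor_1^A(M, N)) − 1. -/
open CategoryTheory Opposite IsLocalRing

noncomputable section

set_option maxHeartbeats 1000000
set_option synthInstance.maxHeartbeats 1000000

/-- Vanishing of `Tor_i^A(M, N)`. -/
abbrev TorZero (A : Type) [CommRing A] (M N : Type) [AddCommGroup M] [Module A M]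
    [AddCommGroup N] [Module A N] (i : ℕ) : Prop :=
  Subsingleton (((Tor (ModuleCat A) i).obj (ModuleCat.of A M)).obj (ModuleCat.of A N))

/-- Vanishing of `Ext^i_A(M, N)`. -/
abbrev ExtZero (A : Type) [CommRing A] (M N : Type) [AddCommGroup M] [Module A M]
    [AddCommGroup N] [Module A N] (i : ℕ) : Prop :=
  Subsingleton (((Ext A (ModuleCat A) i).obj (op (ModuleCat.of A M))).obj (ModuleCat.of A N))

/-- `M` has projective dimension at most `n` over `A`:
`Ext^i_A(M, -) = 0` for all `i > n`. -/
def PdLE (A : Type) [CommRing A] (M : Type) [AddCommGroup M] [Module A M] (n : ℕ) : Prop :=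
  ∀ (N : ModuleCat A) (i : ℕ), n < i →
    Subsingleton (((Ext A (ModuleCat A) i).obj (op (ModuleCat.of A M))).obj N)

/-- `N` has injective dimension at most `n` over `A`:
`Ext^i_A(-, N) = 0` for all `i > n`. -/
def IdLE (A : Type) [CommRing A] (N : Type) [AddCommGroup N] [Module A N] (n : ℕ) : Prop :=
  ∀ (X : ModuleCat A) (i : ℕ), n < i →
    Subsingleton (((Ext A (ModuleCat A) i).obj (op X)).obj (ModuleCat.of A N))

/-- The depth of a module over a noetherian local ring, as an extended natural number:
`inf { i | Ext^i_A(k, M) ≠ 0 }`. -/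
def depthM (A : Type) [CommRing A] [IsLocalRing A] (M : Type) [AddCommGroup M]
    [Module A M] : ℕ∞ :=
  sInf {n : ℕ∞ | ∃ i : ℕ, n = i ∧
    ¬ Subsingleton (((Ext A (ModuleCat A) i).obj
        (op (ModuleCat.of A (A ⧸ maximalIdeal A)))).obj (ModuleCat.of A M))}

/-- The fiber product `S ×ₖ T` as a subring of `S × T`. -/
def fiberProd {S T k : Type} [CommRing S] [CommRing T] [CommRing k]
    (πS : S →+* k) (πT : T →+* k) : Subring (S × T) :=
  RingHom.eqLocus (πS.comp (RingHom.fst S T)) (πT.comp (RingHom.snd S T))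

/-- The projection from the fiber product to `S`. -/
def ρS {S T k : Type} [CommRing S] [CommRing T] [CommRing k]
    (πS : S →+* k) (πT : T →+* k) : ↥(fiberProd πS πT) →+* S :=
  (RingHom.fst S T).comp (fiberProd πS πT).subtype

/-- The projection from the fiber product to `T`. -/
def ρT {S T k : Type} [CommRing S] [CommRing T] [CommRing k]
    (πS : S →+* k) (πT : T →+* k) : ↥(fiberProd πS πT) →+* T :=
  (RingHom.snd S T).comp (fiberProd πS πT).subtype

/-- The `i`-th Betti number of a module `M` over a noetherian local ring `A`:
the `k`-dimension of `Tor_i^A(M, k) ⊗_A k`; since `Tor_i^A(M, k)` is annihilated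
by the maximal ideal, this is `dim_k Tor_i^A(M, k)`. -/
noncomputable def betti (A : Type) [CommRing A] [IsLocalRing A] (M : Type) [AddCommGroup M]
    [Module A M] (i : ℕ) : ℕ :=
  let X : ModuleCat A :=
    ((Tor (ModuleCat A) i).obj (ModuleCat.of A M)).obj (ModuleCat.of A (A ⧸ maximalIdeal A))
  Module.finrank (A ⧸ maximalIdeal A) (X ⧸ (maximalIdeal A • (⊤ : Submodule A X)))

/-- `M` is a first syzygy over `A` of a finitely generated `A`-module, i.e. `M` embeds
into a finite free `A`-module (as the kernel of `F ↠ L` for the quotient `L`). -/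
def IsFirstSyzygy (A : Type) [CommRing A] (M : Type) [AddCommGroup M] [Module A M] : Prop :=
  ∃ (n : ℕ) (f : M →ₗ[A] (Fin n → A)), Function.Injective f

open Limits

/-- The linearized Hom complex out of `P` is exact in degree `n` when every degree `n` cocycle is a
coboundary. -/
lemma linearYonedaObj_exactAt_iff {R : Type} [CommRing R] (P : ChainComplex (ModuleCat.{0} R) ℕ)
    (Y : ModuleCat.{0} R) (n : ℕ) :
    (P.linearYonedaObj R Y).ExactAt n ↔
      ∀ f : P.X n ⟶ Y, P.d (n + 1) n ≫ f = 0 →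
        ∃ g : P.X ((ComplexShape.up ℕ).prev n) ⟶ Y,
          P.d n ((ComplexShape.up ℕ).prev n) ≫ g = f := by
  rw [HomologicalComplex.exactAt_iff' _ ((ComplexShape.up ℕ).prev n) n (n + 1) rfl (by simp),
    ShortComplex.moduleCat_exact_iff]
  rfl

/-- Vanishing of the two versions of `Ext` over a module category agrees. -/
lemma subsingleton_ext_iff {R : Type} [CommRing R] (X Y : ModuleCat.{0} R) (n : ℕ) :
    Subsingleton (((_root_.Ext R (ModuleCat.{0} R) n).obj (op X)).obj Y) ↔
      Subsingleton (Abelian.Ext X Y n) := by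
  let P := projectiveResolution X
  rw [← ModuleCat.isZero_iff_subsingleton, (P.isoExt n Y).isZero_iff,
    ← HomologicalComplex.exactAt_iff_isZero_homology, linearYonedaObj_exactAt_iff]
  cases n with
  | zero =>
    rw [Abelian.Ext.homEquiv₀.subsingleton_congr]
    have hd (Z : ℕ) : P.complex.d 0 Z = 0 := P.complex.shape _ _ (by simp)
    simp only [hd, zero_comp]
    constructor
    · intro h
      refine subsingleton_of_forall_eq 0 fun g => ?_
      obtain ⟨_, h'⟩ := h (P.π.f 0 ≫ g)
        ((P.complex_d_comp_π_f_zero_assoc g).trans zero_comp)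
      have : Epi (P.π.f 0) := inferInstance
      exact (cancel_epi (P.π.f 0)).1 (by rw [← h']; exact comp_zero.symm)
    · intro h f hf
      refine ⟨0, ?_⟩
      rw [← P.exact₀.g_desc f hf]
      have : P.exact₀.desc f hf = 0 := h.elim _ _
      rw [this, comp_zero]
  | succ n =>
    have hp : (ComplexShape.up ℕ).prev (n + 1) = n := by simp
    rw [hp]
    constructor
    · intro h
      refine subsingleton_of_forall_eq 0 fun α => ?_
      obtain ⟨f, hf, rfl⟩ := P.extMk_surjective α (n + 2) rfl
      exact (P.extMk_eq_zero_iff f _ rfl hf n rfl).2 (h f hf)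
    · intro h f hf
      exact (P.extMk_eq_zero_iff f _ rfl hf n rfl).1 (h.elim _ _)

/-- `Ext X Y` vanishes if `Y` is a retract of a finite power of `Z` and `Ext X Z` vanishes. -/
lemma subsingleton_ext_of_sum_comp_eq_id {C : Type*} [Category* C] [Abelian C] [HasExt C]
    {X Y Z : C} {n : ℕ}
    {ι : Type*} [Fintype ι] (f : ι → (Y ⟶ Z)) (g : ι → (Z ⟶ Y)) (h : ∑ i, f i ≫ g i = 𝟙 Y)
    (hZ : Subsingleton (Abelian.Ext X Z n)) : Subsingleton (Abelian.Ext X Y n) := by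
  refine subsingleton_of_forall_eq 0 fun α => ?_
  rw [← α.comp_mk₀_id, ← h, Abelian.Ext.mk₀_sum, Abelian.Ext.comp_sum]
  refine Finset.sum_eq_zero fun i _ => ?_
  rw [← Abelian.Ext.mk₀_comp_mk₀, ← Abelian.Ext.comp_assoc_of_second_deg_zero,
    hZ.elim (α.comp (Abelian.Ext.mk₀ (f i)) (add_zero n)) 0, Abelian.Ext.zero_comp]

/-- The kernel of a morphism inherits the vanishing of `Ext` in degrees at most one. -/
lemma subsingleton_ext_of_exact {C : Type*} [Category* C] [Abelian C] [HasExt C]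
    (S : ShortComplex C) (hS : S.Exact) [Mono S.f] (X : C) (n : ℕ) (hn : n ≤ 1)
    (h₂ : ∀ j ≤ n, Subsingleton (Abelian.Ext X S.X₂ j))
    (h₃ : ∀ j < n, Subsingleton (Abelian.Ext X S.X₃ j)) :
    Subsingleton (Abelian.Ext X S.X₁ n) := by
  have hom_zero {Y : C} (h : Subsingleton (Abelian.Ext X Y 0)) (f : X ⟶ Y) : f = 0 :=
    (Abelian.Ext.homEquiv₀.subsingleton_congr.1 h).elim _ _
  obtain rfl | rfl : n = 0 ∨ n = 1 := by omega
  · rw [Abelian.Ext.homEquiv₀.subsingleton_congr]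
    refine subsingleton_of_forall_eq 0 fun f => ?_
    rw [← cancel_mono S.f, hom_zero (h₂ 0 le_rfl) (f ≫ S.f), zero_comp]
  · let T : ShortComplex C := ShortComplex.mk S.f (Abelian.factorThruImage S.g) (by
      rw [← cancel_mono (Abelian.image.ι S.g)]; simp)
    have hT : T.ShortExact :=
      { exact := by
          let φ : T ⟶ S :=
            { τ₁ := 𝟙 _
              τ₂ := 𝟙 _
              τ₃ := Abelian.image.ι S.g
              comm₁₂ := by simp [T]
              comm₂₃ := by simp [T] }
          have : Epi φ.τ₁ := inferInstanceAs (Epi (𝟙 _))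
          have : IsIso φ.τ₂ := inferInstanceAs (IsIso (𝟙 _))
          have : Mono φ.τ₃ := inferInstanceAs (Mono (Abelian.image.ι S.g))
          exact (ShortComplex.exact_iff_of_epi_of_isIso_of_mono φ).2 hS
        mono_f := inferInstanceAs (Mono S.f)
        epi_g := inferInstanceAs (Epi (Abelian.factorThruImage S.g)) }
    refine subsingleton_of_forall_eq 0 fun α => ?_
    obtain ⟨β, rfl⟩ := Abelian.Ext.covariant_sequence_exact₁ X hT α
      ((h₂ 1 le_rfl).elim _ _) (zero_add 1)
    have : β = 0 := by
      apply Abelian.Ext.homEquiv₀.injective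
      rw [← cancel_mono (Abelian.image.ι S.g)]
      exact (hom_zero (h₃ 0 one_pos) _).trans (hom_zero (h₃ 0 one_pos) _).symm
    rw [this, Abelian.Ext.zero_comp]

/-- The ideal `I` annihilates `Ext (R ⧸ I) Y`. -/
lemma smul_ext_eq_zero {R : Type} [CommRing R] {I : Ideal R} {r : R} (hr : r ∈ I)
    {Y : ModuleCat.{0} R} {n : ℕ} (x : Abelian.Ext (ModuleCat.of R (R ⧸ I)) Y n) : r • x = 0 := by
  have h : r • 𝟙 (ModuleCat.of R (R ⧸ I)) = 0 := by
    ext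
    change r • (1 : R ⧸ I) = 0
    rw [Algebra.smul_def, mul_one]
    exact Ideal.Quotient.eq_zero_iff_mem.2 hr
  rw [← x.mk₀_id_comp, ← Abelian.Ext.smul_comp, ← Abelian.Ext.mk₀_smul, h, Abelian.Ext.mk₀_zero,
    Abelian.Ext.zero_comp]

/-- A map of finite free modules with entries in `I` induces zero on `Ext (R ⧸ I) -`. -/
lemma ext_comp_mk₀_eq_zero {R : Type} [CommRing R] {I : Ideal R} {K : Type} [AddCommGroup K]
    [Module R K] [Module.Free R K] [Module.Finite R K] {m : ℕ} (f : K →ₗ[R] (Fin m → R))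
    (hf : ∀ v j, f v j ∈ I) {n : ℕ}
    (x : Abelian.Ext (ModuleCat.of R (R ⧸ I)) (ModuleCat.of R K) n) :
    x.comp (Abelian.Ext.mk₀ (ModuleCat.ofHom f)) (add_zero n) = 0 := by
  let b := Module.Free.chooseBasis R K
  have h : ModuleCat.ofHom f = ∑ l, ∑ j, f (b l) j •
      ModuleCat.ofHom ((LinearMap.single R (fun _ : Fin m => R) j).comp (b.coord l)) := by
    apply ModuleCat.hom_ext
    simp only [ModuleCat.hom_sum, ModuleCat.hom_smul, ModuleCat.hom_ofHom]
    refine b.ext fun l => funext fun j => ?_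
    simp [LinearMap.sum_apply, Finset.sum_apply, Pi.single_apply, Finsupp.single_apply]
  rw [h, Abelian.Ext.mk₀_sum, Abelian.Ext.comp_sum]
  refine Finset.sum_eq_zero fun l _ => ?_
  rw [Abelian.Ext.mk₀_sum, Abelian.Ext.comp_sum]
  refine Finset.sum_eq_zero fun j _ => ?_
  rw [Abelian.Ext.mk₀_smul, Abelian.Ext.comp_smul, smul_ext_eq_zero (hf _ _)]

/-- A finite module over a local ring has a minimal free cover. -/
lemma exists_minimal_free_cover (A : Type*) [CommRing A] [IsLocalRing A] (M : Type*)
    [AddCommGroup M] [Module A M] [Module.Finite A M] :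
    ∃ (m : ℕ) (φ : (Fin m → A) →ₗ[A] M), Function.Surjective φ ∧
      ∀ v ∈ φ.ker, ∀ j, v j ∈ maximalIdeal A := by
  classical
  have hex := Module.Finite.exists_fin' A M
  obtain ⟨φ, hφ⟩ := Nat.find_spec hex
  have hmin {m : ℕ} := Nat.find_min hex (m := m)
  generalize Nat.find hex = m at φ hmin
  refine ⟨m, φ, hφ, fun v hv j => ?_⟩
  by_contra hj
  obtain ⟨u, hu⟩ : IsUnit (v j) := by simpa using hj
  obtain _ | m := m
  · exact j.elim0
  refine hmin (Nat.lt_succ_self m)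
    ⟨φ ∘ₗ Function.ExtendByZero.linearMap A j.succAbove, fun x => ?_⟩
  obtain ⟨w, rfl⟩ := hφ x
  refine ⟨fun i => (w - (w j * ↑u⁻¹) • v) (j.succAbove i), ?_⟩
  have hw : Function.ExtendByZero.linearMap A j.succAbove
      (fun i => (w - (w j * ↑u⁻¹) • v) (j.succAbove i)) = w - (w j * ↑u⁻¹) • v := by
    ext i
    rcases Fin.eq_self_or_eq_succAbove j i with rfl | ⟨i, rfl⟩
    · simp [← hu]
    · simp [Fin.succAbove_right_injective.extend_apply]
  rw [LinearMap.comp_apply, hw, map_sub, map_smul, LinearMap.mem_ker.1 hv, smul_zero, sub_zero]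

/-- A free cover whose kernel is free, nonzero and has coefficients in the maximal ideal presents
a module whose depth is smaller than that of the ring. -/
lemma exists_not_subsingleton_ext {A : Type} [CommRing A] [IsLocalRing A]
    {M : Type} [AddCommGroup M] [Module A M] {m : ℕ} (φ : (Fin m → A) →ₗ[A] M)
    (hφ : Function.Surjective φ) (hmin : ∀ v ∈ φ.ker, ∀ j, v j ∈ maximalIdeal A)
    [Module.Free A φ.ker] [Module.Finite A φ.ker] [Nontrivial φ.ker] {i : ℕ}
    (hi : ¬ Subsingleton (Abelian.Ext (ModuleCat.of A (A ⧸ maximalIdeal A)) (ModuleCat.of A A) i)) :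
    ∃ j, j + 1 = i ∧
      ¬ Subsingleton (Abelian.Ext (ModuleCat.of A (A ⧸ maximalIdeal A)) (ModuleCat.of A M) j) := by
  have hS := LinearMap.shortExact_shortComplexKer hφ
  have hzero {n : ℕ} (x : Abelian.Ext (ModuleCat.of A (A ⧸ maximalIdeal A))
      φ.shortComplexKer.X₁ n) :
      x.comp (Abelian.Ext.mk₀ φ.shortComplexKer.f) (add_zero n) = 0 :=
    ext_comp_mk₀_eq_zero φ.ker.subtype (fun v j => hmin v v.2 j) x
  have hK : ¬ Subsingleton
      (Abelian.Ext (ModuleCat.of A (A ⧸ maximalIdeal A)) φ.shortComplexKer.X₁ i) := by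
    intro h
    let b := Module.Free.chooseBasis A φ.ker
    obtain ⟨l⟩ : Nonempty (Module.Free.ChooseBasisIndex A φ.ker) := b.index_nonempty
    refine hi (subsingleton_ext_of_sum_comp_eq_id (ι := Unit)
      (fun _ => ModuleCat.ofHom (LinearMap.toSpanSingleton A φ.ker (b l)))
      (fun _ => ModuleCat.ofHom (b.coord l)) ?_ h)
    ext
    simp
  cases i with
  | zero =>
    refine (hK ?_).elim
    rw [Abelian.Ext.homEquiv₀.subsingleton_congr]
    refine subsingleton_of_forall_eq 0 fun g => ?_
    have := hS.mono_f
    have h := hzero (Abelian.Ext.mk₀ g)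
    rw [Abelian.Ext.mk₀_comp_mk₀] at h
    rw [← cancel_mono φ.shortComplexKer.f, zero_comp]
    exact (Abelian.Ext.mk₀_bijective _ _).1 (h.trans (Abelian.Ext.mk₀_zero _ _).symm)
  | succ j =>
    refine ⟨j, rfl, fun h => hK (subsingleton_of_forall_eq 0 fun x => ?_)⟩
    obtain ⟨y, rfl⟩ := Abelian.Ext.covariant_sequence_exact₁ _ hS x (hzero x) rfl
    rw [(show Subsingleton (Abelian.Ext _ φ.shortComplexKer.X₃ j) from h).elim y 0,
      Abelian.Ext.zero_comp]

open MonoidalCategory in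
/-- Tensoring a short exact sequence whose first two terms are flat with `N` presents `Tor₁` as a
kernel. -/
lemma exists_exact_tor_one {R : Type} [CommRing R] {S : ShortComplex (ModuleCat.{0} R)}
    (hS : S.ShortExact) [Module.Flat R S.X₂] (N : ModuleCat.{0} R) :
    ∃ T : ShortComplex (ModuleCat.{0} R), T.Exact ∧ Mono T.f ∧
      Nonempty (((Tor (ModuleCat.{0} R) 1).obj S.X₃).obj N ≅ T.X₁) ∧
      Nonempty (S.X₁ ⊗ N ≅ T.X₂) ∧ Nonempty (S.X₂ ⊗ N ≅ T.X₃) := by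
  let P := projectiveResolution N
  let K := fun X => (((tensoringLeft (ModuleCat.{0} R)).obj X).mapHomologicalComplex
    (ComplexShape.down ℕ)).obj P.complex
  let U : ShortComplex (ChainComplex (ModuleCat.{0} R) ℕ) :=
    ShortComplex.mk (X₁ := K S.X₁) (X₂ := K S.X₂) (X₃ := K S.X₃)
      ((NatTrans.mapHomologicalComplex ((tensoringLeft _).map S.f) _).app P.complex)
      ((NatTrans.mapHomologicalComplex ((tensoringLeft _).map S.g) _).app P.complex) (by
        ext1 i
        change S.f ▷ P.complex.X i ≫ S.g ▷ P.complex.X i = 0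
        rw [← comp_whiskerRight, S.zero, MonoidalPreadditive.zero_whiskerRight])
  have hU : U.ShortExact := by
    refine HomologicalComplex.shortExact_of_degreewise_shortExact U fun i => ?_
    have : Module.Projective R (P.complex.X i) :=
      (IsProjective.iff_projective _).2 (P.projective i)
    exact hS.map_of_exact (tensorRight (P.complex.X i))
  have iso (X : ModuleCat.{0} R) : X ⊗ N ≅ (K X).homology 0 :=
    (((tensoringLeft _).obj X).leftDerivedZeroIsoSelf.app N).symm ≪≫ P.isoLeftDerivedObj _ 0
  have h1 : IsZero (U.X₂.homology 1) := by
    rw [← HomologicalComplex.exactAt_iff_isZero_homology,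
      HomologicalComplex.exactAt_iff' _ 2 1 0 (by simp) (by simp)]
    exact (P.exact_succ 0).map (tensorLeft S.X₂)
  exact ⟨_, hU.homology_exact₁ 1 0 rfl, hU.mono_δ 1 0 rfl h1,
    ⟨P.isoLeftDerivedObj _ 1⟩, ⟨iso _⟩, ⟨iso _⟩⟩

open MonoidalCategory in
/-- Tensoring with a finite free module preserves the vanishing of `Ext X -`. -/
lemma subsingleton_ext_tensor {R : Type} [CommRing R] (X F N : ModuleCat.{0} R)
    [Module.Free R F] [Module.Finite R F] {n : ℕ} (h : Subsingleton (Abelian.Ext X N n)) :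
    Subsingleton (Abelian.Ext X (F ⊗ N) n) := by
  let b := Module.Free.chooseBasis R F
  refine subsingleton_ext_of_sum_comp_eq_id
    (fun j => ModuleCat.ofHom (TensorProduct.lift ((LinearMap.lsmul R N).comp (b.coord j))))
    (fun j => ModuleCat.ofHom (TensorProduct.mk R F N (b j))) ?_ h
  apply ModuleCat.hom_ext
  refine TensorProduct.ext' fun x y => ?_
  simp only [ModuleCat.hom_sum, ModuleCat.hom_comp, ModuleCat.hom_ofHom, ModuleCat.hom_id]
  rw [LinearMap.sum_apply]
  change ∑ j, b j ⊗ₜ[R] (b.repr x j • y) = x ⊗ₜ[R] y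
  simp only [← TensorProduct.smul_tmul]
  rw [← TensorProduct.sum_tmul, b.sum_repr]

lemma subsingleton_ext_of_iso {C : Type*} [Category* C] [Abelian C] [HasExt C] {X Y Z : C}
    (e : Y ≅ Z) {n : ℕ} (h : Subsingleton (Abelian.Ext X Z n)) :
    Subsingleton (Abelian.Ext X Y n) :=
  subsingleton_ext_of_sum_comp_eq_id (ι := Unit) (fun _ => e.hom) (fun _ => e.inv) (by simp) h

lemma depthM_le_natCast {A : Type} [CommRing A] [IsLocalRing A] {M : Type} [AddCommGroup M]
    [Module A M] {n : ℕ} (hn : ¬ Subsingleton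
      (Abelian.Ext (ModuleCat.of A (A ⧸ maximalIdeal A)) (ModuleCat.of A M) n)) :
    depthM A M ≤ n := by
  rw [← subsingleton_ext_iff] at hn
  exact csInf_le' ⟨n, rfl, hn⟩

lemma natCast_lt_depthM_iff {A : Type} [CommRing A] [IsLocalRing A] (M : Type) [AddCommGroup M]
    [Module A M] (n : ℕ) : n < depthM A M ↔ ∀ j ≤ n,
      Subsingleton (Abelian.Ext (ModuleCat.of A (A ⧸ maximalIdeal A)) (ModuleCat.of A M) j) := by
  constructor
  · intro h j hj
    by_contra hM
    exact (h.trans_le ((depthM_le_natCast hM).trans (Nat.cast_le.2 hj))).false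
  · intro h
    refine lt_of_lt_of_le (Nat.cast_lt.2 n.lt_succ_self) (le_sInf ?_)
    rintro _ ⟨i, rfl, hi⟩
    rw [subsingleton_ext_iff] at hi
    by_contra hlt
    exact hi (h i (Nat.lt_succ_iff.1 (lt_of_not_ge fun hle => hlt (Nat.cast_le.2 hle))))

/-- The kernel of a finite free cover of a finite module of projective dimension at most one is
free. -/
lemma free_ker_of_pdLE_one {A : Type} [CommRing A] [IsNoetherianRing A] [IsLocalRing A]
    {M : Type} [AddCommGroup M] [Module A M] {m : ℕ} (φ : (Fin m → A) →ₗ[A] M)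
    (hφ : Function.Surjective φ) (hpd1 : PdLE A M 1) : Module.Free A φ.ker := by
  have : HasProjectiveDimensionLT (ModuleCat.of A M) 2 :=
    .mk fun i hi Y e => ((subsingleton_ext_iff _ Y i).1 (hpd1 Y i hi)).elim e 0
  have hS := LinearMap.shortExact_shortComplexKer hφ
  have hproj : Projective φ.shortComplexKer.X₂ :=
    (IsProjective.iff_projective (Fin m → A)).1 inferInstance
  have hK := (hS.hasProjectiveDimensionLT_X₃_iff 0 hproj).1 this
  have : Module.Projective A φ.ker :=
    (IsProjective.iff_projective φ.ker).2
      (projective_iff_hasProjectiveDimensionLT_one.2 hK)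
  exact Module.free_of_flat_of_isLocalRing

lemma nontrivial_ker_of_not_pdLE_zero {A : Type} [CommRing A]
    {M : Type} [AddCommGroup M] [Module A M] {m : ℕ} (φ : (Fin m → A) →ₗ[A] M)
    (hφ : Function.Surjective φ) (hpd0 : ¬ PdLE A M 0) : Nontrivial φ.ker := by
  by_contra h
  rw [not_nontrivial_iff_subsingleton] at h
  have : Module.Projective A M := .of_equiv (LinearEquiv.ofBijective φ
    ⟨LinearMap.ker_eq_bot.1 (Submodule.subsingleton_iff_eq_bot.1 h), hφ⟩)
  have : Projective (ModuleCat.of A M) := (IsProjective.iff_projective M).1 this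
  refine hpd0 fun Y i hi => ?_
  obtain ⟨i, rfl⟩ := Nat.exists_eq_succ_of_ne_zero hi.ne'
  rw [subsingleton_ext_iff]
  exact HasProjectiveDimensionLT.subsingleton _ 1 _ (by omega) _

/-- If the first syzygy in a finite free cover of `M` is free and `N` has depth at most two, then
`Tor₁ M N` has at least the depth of `N`. -/
lemma depthM_le_depthM_tor_one {A : Type} [CommRing A] [IsNoetherianRing A] [IsLocalRing A]
    {M : Type} [AddCommGroup M] [Module A M] {m : ℕ} (φ : (Fin m → A) →ₗ[A] M)
    (hφ : Function.Surjective φ) [Module.Free A φ.ker]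
    (N : Type) [AddCommGroup N] [Module A N] (hdepth : depthM A N ≤ 2) :
    depthM A N ≤ depthM A
      (((Tor (ModuleCat A) 1).obj (ModuleCat.of A M)).obj (ModuleCat.of A N)) := by
  have hS := LinearMap.shortExact_shortComplexKer hφ
  have : Module.Free A φ.shortComplexKer.X₁ := inferInstanceAs (Module.Free A φ.ker)
  have : Module.Finite A φ.shortComplexKer.X₁ := inferInstanceAs (Module.Finite A φ.ker)
  have : Module.Free A φ.shortComplexKer.X₂ := inferInstanceAs (Module.Free A (Fin m → A))
  have : Module.Finite A φ.shortComplexKer.X₂ := inferInstanceAs (Module.Finite A (Fin m → A))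
  obtain ⟨T, hT, hmono, ⟨e₁⟩, ⟨e₂⟩, ⟨e₃⟩⟩ := exists_exact_tor_one hS (ModuleCat.of A N)
  refine le_sInf ?_
  rintro _ ⟨i, rfl, hi⟩
  by_contra! hlt
  rw [subsingleton_ext_iff] at hi
  have hi1 : i ≤ 1 := Nat.lt_succ_iff.1 (Nat.cast_lt.1 (hlt.trans_le hdepth))
  have h := (natCast_lt_depthM_iff N i).1 hlt
  exact hi (subsingleton_ext_of_iso e₁ (subsingleton_ext_of_exact T hT _ i hi1
    (fun j hj => subsingleton_ext_of_iso e₂.symm (subsingleton_ext_tensor _ _ _ (h j hj)))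
    (fun j hj => subsingleton_ext_of_iso e₃.symm (subsingleton_ext_tensor _ _ _ (h j hj.le)))))

/-- Proposition 3.4: over a commutative noetherian local ring `A`, if `pd_A M = 1` and
`depth_A N ≤ 2`, then `depth_A M + depth_A N ≤ depth A + depth_A Tor_1^A(M,N) − 1`. -/
theorem stmt_13 (A : Type) [CommRing A] [IsNoetherianRing A] [IsLocalRing A]
    (M N : Type) [AddCommGroup M] [Module A M] [Module.Finite A M]
    [AddCommGroup N] [Module A N] [Module.Finite A N]
    (hpd1 : PdLE A M 1) (hpd0 : ¬ PdLE A M 0)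
    (hdepth : depthM A N ≤ 2) :
    depthM A M + depthM A N ≤
      depthM A A +
        depthM A (((Tor (ModuleCat A) 1).obj (ModuleCat.of A M)).obj (ModuleCat.of A N)) -
        1 := by
  obtain ⟨m, φ, hφ, hmin⟩ := exists_minimal_free_cover A M
  have := free_ker_of_pdLE_one φ hφ hpd1
  have := nontrivial_ker_of_not_pdLE_zero φ hφ hpd0
  have hM : depthM A M + 1 ≤ depthM A A := by
    refine le_sInf ?_
    rintro _ ⟨i, rfl, hi⟩
    rw [subsingleton_ext_iff] at hi
    obtain ⟨j, rfl, hj⟩ := exists_not_subsingleton_ext φ hφ hmin hi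
    push_cast
    exact add_le_add_left (depthM_le_natCast hj) 1
  have hN := depthM_le_depthM_tor_one φ hφ N hdepth
  refine ENat.le_sub_of_add_le_right ENat.one_ne_top ?_
  rw [add_right_comm]
  exact add_le_add hM hN
end
end

section
/- Let R = S ×_k T be a non-trivial fiber product and let M, N be finitely generated R-modules. If Ext_R^i(M, N) = 0 for all sufficiently large i, then M has projective dimension at most 1 over R or N has injective dimension at most 1 over R. -/
open CategoryTheory Opposite IsLocalRing

noncomputable section

set_option maxHeartbeats 1000000
set_option synthInstance.maxHeartbeats 1000000

section Comparison

variable {A : Type} [CommRing A]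

/-- In positive degrees, `Ext` computed by derived functors vanishes if and only if
`Ext` computed in the derived category does. -/
lemma subsingleton_ext_succ_iff (X Y : ModuleCat.{0} A) (n : ℕ) :
    Subsingleton (((Ext A (ModuleCat A) (n + 1)).obj (op X)).obj Y) ↔
      Subsingleton (Abelian.Ext X Y (n + 1)) := by
  let P := ProjectiveResolution.of X
  rw [← ModuleCat.isZero_iff_subsingleton,
    (P.isoExt (R := A) (n + 1) Y).isZero_iff, ← HomologicalComplex.exactAt_iff_isZero_homology,
    HomologicalComplex.exactAt_iff' _ n (n + 1) (n + 2) (by simp) (by simp),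
    ShortComplex.moduleCat_exact_iff]
  constructor
  · intro h
    refine subsingleton_of_forall_eq 0 fun e ↦ ?_
    obtain ⟨f, hf, rfl⟩ := P.extMk_surjective e (n + 2) rfl
    rw [P.extMk_eq_zero_iff f (n + 2) rfl hf n rfl]
    exact h f hf
  · intro h (f : P.complex.X (n + 1) ⟶ Y) hf
    exact (P.extMk_eq_zero_iff f (n + 2) rfl hf n rfl).1 (Subsingleton.elim _ _)

end Comparison

section DimensionShift

variable {A : Type} [CommRing A] {X Y Z : Type} [AddCommGroup X] [Module A X]
  [AddCommGroup Y] [Module A Y] [AddCommGroup Z] [Module A Z]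

lemma subsingleton_ext_of_leftInverse {N : ModuleCat.{0} A} {n : ℕ} (c : X →ₗ[A] Y)
    (r : Y →ₗ[A] X) (h : ∀ x, r (c x) = x)
    (hY : Subsingleton (Abelian.Ext (ModuleCat.of A Y) N n)) :
    Subsingleton (Abelian.Ext (ModuleCat.of A X) N n) := by
  refine subsingleton_of_forall_eq 0 fun e ↦ ?_
  have hid : ModuleCat.ofHom c ≫ ModuleCat.ofHom r = 𝟙 (ModuleCat.of A X) := by
    ext x
    simp [h]
  rw [← e.mk₀_id_comp, ← hid, ← Abelian.Ext.mk₀_comp_mk₀_assoc,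
    Subsingleton.elim ((Abelian.Ext.mk₀ (ModuleCat.ofHom r)).comp e (zero_add n)) 0,
    Abelian.Ext.comp_zero]

lemma subsingleton_ext_mid {f : X →ₗ[A] Y} {g : Y →ₗ[A] Z} (hf : Function.Injective f)
    (hg : Function.Surjective g) (hfg : Function.Exact f g) {N : ModuleCat.{0} A} {n : ℕ}
    (hX : Subsingleton (Abelian.Ext (ModuleCat.of A X) N n))
    (hZ : Subsingleton (Abelian.Ext (ModuleCat.of A Z) N n)) :
    Subsingleton (Abelian.Ext (ModuleCat.of A Y) N n) := by
  have hS := ModuleCat.shortComplex_shortExact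
    (ModuleCat.shortComplexOfCompEqZero f g hfg.linearMap_comp_eq_zero) hfg hf hg
  refine subsingleton_of_forall_eq 0 fun e ↦ ?_
  obtain ⟨e', rfl⟩ := Abelian.Ext.contravariant_sequence_exact₂ hS N e (hX.elim _ _)
  rw [hZ.elim e' 0, Abelian.Ext.comp_zero]

lemma subsingleton_ext_succ_quotient {f : X →ₗ[A] Y} {g : Y →ₗ[A] Z} (hf : Function.Injective f)
    (hg : Function.Surjective g) (hfg : Function.Exact f g) [Module.Projective A Y]
    {N : ModuleCat.{0} A} {n : ℕ}
    (hX : Subsingleton (Abelian.Ext (ModuleCat.of A X) N n)) :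
    Subsingleton (Abelian.Ext (ModuleCat.of A Z) N (n + 1)) := by
  have hS := ModuleCat.shortComplex_shortExact
    (ModuleCat.shortComplexOfCompEqZero f g hfg.linearMap_comp_eq_zero) hfg hf hg
  have : Projective (ModuleCat.shortComplexOfCompEqZero f g hfg.linearMap_comp_eq_zero).X₂ :=
    inferInstanceAs (Projective (ModuleCat.of A Y))
  refine subsingleton_of_forall_eq 0 fun e ↦ ?_
  obtain ⟨e', rfl⟩ := Abelian.Ext.contravariant_sequence_exact₃ hS N e
    (Abelian.Ext.eq_zero_of_projective _) (add_comm 1 n)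
  rw [hX.elim e' 0, Abelian.Ext.comp_zero]

lemma subsingleton_ext_sub {f : X →ₗ[A] Y} {g : Y →ₗ[A] Z} (hf : Function.Injective f)
    (hg : Function.Surjective g) (hfg : Function.Exact f g) [Module.Projective A Y]
    {N : ModuleCat.{0} A} {n : ℕ}
    (hZ : Subsingleton (Abelian.Ext (ModuleCat.of A Z) N (n + 2))) :
    Subsingleton (Abelian.Ext (ModuleCat.of A X) N (n + 1)) := by
  have hS := ModuleCat.shortComplex_shortExact
    (ModuleCat.shortComplexOfCompEqZero f g hfg.linearMap_comp_eq_zero) hfg hf hg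
  have : Projective (ModuleCat.shortComplexOfCompEqZero f g hfg.linearMap_comp_eq_zero).X₂ :=
    inferInstanceAs (Projective (ModuleCat.of A Y))
  refine subsingleton_of_forall_eq 0 fun e ↦ ?_
  obtain ⟨e', rfl⟩ := Abelian.Ext.contravariant_sequence_exact₁ hS N e (add_comm 1 (n + 1))
    (hZ.elim _ _)
  rw [Abelian.Ext.eq_zero_of_projective e', Abelian.Ext.comp_zero]

end DimensionShift

section CyclicModules

variable {R : Type} [CommRing R]

/-- Multiplication by `x` as a map `R ⧸ b → R ⧸ a`, where `b = (a : x)`. -/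
def mulQuotient {a b : Ideal R} {x : R} (h : ∀ y, y ∈ b ↔ x * y ∈ a) : (R ⧸ b) →ₗ[R] (R ⧸ a) :=
  Submodule.mapQ b a (LinearMap.lsmul R R x) fun y hy ↦ (h y).1 hy

lemma mulQuotient_mk {a b : Ideal R} {x : R} (h : ∀ y, y ∈ b ↔ x * y ∈ a) (y : R) :
    mulQuotient h (Ideal.Quotient.mk b y) = Ideal.Quotient.mk a (x * y) := rfl

lemma mulQuotient_injective {a b : Ideal R} {x : R} (h : ∀ y, y ∈ b ↔ x * y ∈ a) :
    Function.Injective (mulQuotient h) := by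
  rw [injective_iff_map_eq_zero]
  intro y hy
  obtain ⟨y, rfl⟩ := Ideal.Quotient.mk_surjective y
  rw [mulQuotient_mk, Ideal.Quotient.eq_zero_iff_mem] at hy
  exact Ideal.Quotient.eq_zero_iff_mem.2 ((h y).2 hy)

lemma mulQuotient_exact {a b : Ideal R} {x : R} (h : ∀ y, y ∈ b ↔ x * y ∈ a) :
    Function.Exact (mulQuotient h)
      (Submodule.factor le_sup_left : (R ⧸ a) →ₗ[R] (R ⧸ (a ⊔ Ideal.span {x}))) := by
  intro y
  obtain ⟨y, rfl⟩ := Ideal.Quotient.mk_surjective y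
  change Ideal.Quotient.mk (a ⊔ Ideal.span {x}) y = 0 ↔ _
  rw [Ideal.Quotient.eq_zero_iff_mem, Submodule.mem_sup]
  constructor
  · rintro ⟨c, hc, d, hd, rfl⟩
    obtain ⟨d, rfl⟩ := Ideal.mem_span_singleton'.1 hd
    refine ⟨Ideal.Quotient.mk b d, ?_⟩
    rw [mulQuotient_mk, Ideal.Quotient.eq]
    convert a.neg_mem hc using 1
    ring
  · rintro ⟨c, hc⟩
    obtain ⟨c, rfl⟩ := Ideal.Quotient.mk_surjective c
    rw [mulQuotient_mk, Ideal.Quotient.eq] at hc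
    exact ⟨y - x * c, by rw [← neg_sub]; exact a.neg_mem hc, x * c,
      Ideal.mul_mem_right _ _ (Ideal.mem_span_singleton_self x), by ring⟩

variable [IsLocalRing R] [IsNoetherianRing R]

/-- By Nakayama, vanishing of `Ext^{n+1}` at `R ⧸ (p + x)` gives vanishing of `Ext^n`
at `R ⧸ p`, where `p` is prime. -/
lemma subsingleton_ext_quotient_prime (N : ModuleCat.{0} R) [Module.Finite R N] (n : ℕ)
    (p : Ideal R) (hp : p.IsPrime) (x : R) (hxm : x ∈ maximalIdeal R) (hxp : x ∉ p)
    (h : Subsingleton (Abelian.Ext (ModuleCat.of R (R ⧸ (p ⊔ Ideal.span {x}))) N (n + 1))) :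
    Subsingleton (Abelian.Ext (ModuleCat.of R (R ⧸ p)) N n) := by
  have hx : ∀ y, y ∈ p ↔ x * y ∈ p := fun y ↦
    ⟨fun hy ↦ p.mul_mem_left x hy, fun hy ↦ (hp.mem_or_mem hy).resolve_left hxp⟩
  have hfg := mulQuotient_exact hx
  have hS := ModuleCat.shortComplex_shortExact
    (ModuleCat.shortComplexOfCompEqZero _ _ hfg.linearMap_comp_eq_zero) hfg
    (mulQuotient_injective hx) (Submodule.factor_surjective le_sup_left)
  have hle : (⊤ : Submodule R (Abelian.Ext (ModuleCat.of R (R ⧸ p)) N n)) ≤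
      maximalIdeal R • ⊤ := by
    intro e _
    obtain ⟨e', rfl⟩ := Abelian.Ext.contravariant_sequence_exact₁ hS N e (add_comm 1 n)
      (h.elim _ _)
    have hmul : ModuleCat.ofHom (mulQuotient hx) = x • 𝟙 (ModuleCat.of R (R ⧸ p)) := by
      ext
      rfl
    have : (Abelian.Ext.mk₀ (ModuleCat.ofHom (mulQuotient hx))).comp e' (zero_add n) = x • e' := by
      rw [hmul, Abelian.Ext.mk₀_smul]
      simp
    exact (congrArg (· ∈ maximalIdeal R • (⊤ : Submodule R _)) this).mpr
      (Submodule.smul_mem_smul hxm trivial)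
  have := Submodule.eq_bot_of_le_smul_of_le_jacobson_bot (maximalIdeal R) ⊤
    (Module.Finite.fg_top) hle (maximalIdeal_le_jacobson _)
  exact (Submodule.subsingleton_iff R).1 (subsingleton_of_bot_eq_top this.symm)

/-- Over a noetherian local ring, the vanishing of `Ext^i(k, N)` for `i ≥ n` and `N` finite implies
that of `Ext^i(R ⧸ a, N)` for all ideals `a`, in the same range. -/
lemma subsingleton_ext_quotient (N : ModuleCat.{0} R) [Module.Finite R N] (n : ℕ)
    (h : ∀ i ≥ n, Subsingleton (Abelian.Ext (ModuleCat.of R (R ⧸ maximalIdeal R)) N i))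
    (a : Ideal R) :
    ∀ i ≥ n, Subsingleton (Abelian.Ext (ModuleCat.of R (R ⧸ a)) N i) := by
  induction a using WellFoundedGT.induction with
  | ind a ih =>
  intro i hi
  have lt_sup {x : R} (hx : x ∉ a) : a < a ⊔ Ideal.span {x} :=
    left_lt_sup.2 fun hle ↦ hx (hle (Ideal.mem_span_singleton_self x))
  by_cases htop : a = ⊤
  · have : Subsingleton (R ⧸ a) := Ideal.Quotient.subsingleton_iff.2 htop
    have hz : Limits.IsZero (ModuleCat.of R (R ⧸ a)) := ModuleCat.isZero_of_subsingleton _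
    refine subsingleton_of_forall_eq 0 fun e ↦ ?_
    rw [← e.mk₀_id_comp, hz.eq_zero_of_src (𝟙 _), Abelian.Ext.mk₀_zero, Abelian.Ext.zero_comp]
  by_cases hp : a.IsPrime
  · by_cases hm : a = maximalIdeal R
    · rw [hm]
      exact h i hi
    · obtain ⟨x, hxm, hxa⟩ := SetLike.exists_of_lt ((le_maximalIdeal htop).lt_of_ne hm)
      exact subsingleton_ext_quotient_prime N i a hp x hxm hxa (ih _ (lt_sup hxa) _ (by lia))
  · obtain ⟨x, hx, y, hy, hxy⟩ : ∃ x, x ∉ a ∧ ∃ y, y ∉ a ∧ x * y ∈ a := by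
      by_contra! hcon
      exact hp ⟨htop, fun {x y} hxy ↦ or_iff_not_imp_left.2 fun hx ↦
        by_contra fun hy ↦ hcon x hx y hy hxy⟩
    let b : Ideal R := Submodule.comap (LinearMap.lsmul R R x) a
    have hb : ∀ y, y ∈ b ↔ x * y ∈ a := fun _ ↦ Iff.rfl
    have hab : a < b := lt_of_le_of_ne (fun z hz ↦ a.mul_mem_left x hz)
      fun hab ↦ hy (hab ▸ (hb y).2 hxy)
    exact subsingleton_ext_mid (mulQuotient_injective hb) (Submodule.factor_surjective _)
      (mulQuotient_exact hb) (ih b hab i hi) (ih _ (lt_sup hx) i hi)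

end CyclicModules

section InjectiveDimension

variable {R : Type} [CommRing R]

lemma injective_of_subsingleton_ext_one_quotient (N : ModuleCat.{0} R)
    (h : ∀ a : Ideal R, Subsingleton (Abelian.Ext (ModuleCat.of R (R ⧸ a)) N 1)) :
    Injective N := by
  have hB : Module.Baer R N := by
    intro a g
    have hfg : Function.Exact a.subtype a.mkQ := LinearMap.exact_subtype_mkQ a
    have hS := ModuleCat.shortComplex_shortExact
      (ModuleCat.shortComplexOfCompEqZero _ _ hfg.linearMap_comp_eq_zero) hfg
      a.injective_subtype a.mkQ_surjective
    obtain ⟨e, he⟩ := Abelian.Ext.contravariant_sequence_exact₁ hS N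
      (Abelian.Ext.mk₀ (ModuleCat.ofHom g)) (add_comm 1 0) ((h a).elim _ _)
    obtain ⟨φ, rfl⟩ := Abelian.Ext.homEquiv₀.symm.surjective e
    have hφ : ModuleCat.ofHom a.subtype ≫ φ = ModuleCat.ofHom g :=
      Abelian.Ext.homEquiv₀.symm.injective (by simpa using he)
    exact ⟨φ.hom, fun x hx ↦
      DFunLike.congr_fun (congrArg ModuleCat.Hom.hom hφ) ⟨x, hx⟩⟩
  have : Module.Injective R N := hB.injective
  exact Module.injective_object_of_injective_module R N

lemma hasInjectiveDimensionLT_two_of_quotient (N : ModuleCat.{0} R)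
    (h : ∀ a : Ideal R, Subsingleton (Abelian.Ext (ModuleCat.of R (R ⧸ a)) N 2)) :
    HasInjectiveDimensionLT N 2 := by
  obtain ⟨E, _, f, _⟩ := EnoughInjectives.presentation N
  let S := ShortComplex.mk f (Limits.cokernel.π f) (by simp)
  have hS : S.ShortExact := { exact := ShortComplex.exact_cokernel f }
  have hE : Injective S.X₂ := ‹Injective E›
  refine (hS.hasInjectiveDimensionLT_X₃_iff 0 hE).1 ?_
  rw [zero_add, ← injective_iff_hasInjectiveDimensionLT_one]
  refine injective_of_subsingleton_ext_one_quotient _ fun a ↦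
    subsingleton_of_forall_eq 0 fun e ↦ ?_
  obtain ⟨e', rfl⟩ := Abelian.Ext.covariant_sequence_exact₃ _ hS e (one_add_one_eq_two)
    ((h a).elim _ _)
  rw [Abelian.Ext.eq_zero_of_injective e', Abelian.Ext.zero_comp]

end InjectiveDimension

section MinimalCover

variable {R : Type} [CommRing R] [IsLocalRing R] {X : Type} [AddCommGroup X] [Module R X]

/-- A finite module over a local ring has a free cover whose kernel lies in `𝔪F`. -/
lemma exists_minimal_cover [Module.Finite R X] :
    ∃ (ι : Type) (_ : Fintype ι) (_ : DecidableEq ι) (f : (ι → R) →ₗ[R] X),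
      Function.Surjective f ∧ ∀ v, f v = 0 → ∀ i, v i ∈ maximalIdeal R := by
  classical
  have hex : ∃ n, ∃ s : Finset X, s.card = n ∧ Submodule.span R (s : Set X) = ⊤ := by
    obtain ⟨s, hs⟩ := Module.Finite.fg_top (R := R) (M := X)
    exact ⟨_, s, rfl, hs⟩
  obtain ⟨s, hcard, hs⟩ := Nat.find_spec hex
  refine ⟨s, inferInstance, inferInstance, Fintype.linearCombination R (fun x : s ↦ (x : X)),
    ?_, fun v hv i ↦ ?_⟩
  · rw [← LinearMap.range_eq_top, Fintype.range_linearCombination]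
    simpa using hs
  · by_contra hvi
    obtain ⟨u, hu⟩ : IsUnit (v i) := by simpa using hvi
    have hi : (i : X) ∈ Submodule.span R ((s.erase i : Finset X) : Set X) := by
      rw [Fintype.linearCombination_apply, ← Finset.add_sum_erase _ _ (Finset.mem_univ i),
        add_eq_zero_iff_eq_neg] at hv
      have hmem : v i • (i : X) ∈ Submodule.span R ((s.erase i : Finset X) : Set X) := by
        rw [hv]
        refine Submodule.neg_mem _ (Submodule.sum_mem _ fun j hj ↦ Submodule.smul_mem _ _ ?_)
        refine Submodule.subset_span ?_
        exact Finset.mem_coe.2 (Finset.mem_erase.2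
          ⟨fun h ↦ Finset.ne_of_mem_erase hj (Subtype.ext h), j.2⟩)
      rw [← hu] at hmem
      have hinv := Submodule.smul_mem _ (↑u⁻¹ : R) hmem
      rwa [smul_smul, Units.inv_mul, one_smul] at hinv
    have htop : Submodule.span R ((s.erase i : Finset X) : Set X) = ⊤ := by
      rw [eq_top_iff, ← hs, Submodule.span_le]
      intro x hx
      by_cases hxi : x = i
      · exact hxi ▸ hi
      · exact Submodule.subset_span (by simpa [hxi] using hx)
    refine Nat.find_min hex ?_ ⟨s.erase i, rfl, htop⟩
    rw [← hcard]
    exact Finset.card_erase_lt_of_mem i.2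

end MinimalCover

section DecomposableMaximalIdeal

/-- A retraction of an internal direct sum onto its first summand. -/
lemma exists_retraction_of_disjoint {R G : Type} [CommRing R] [AddCommGroup G] [Module R G]
    {K A B : Submodule R G} (hK : A ⊔ B = K) (h : Disjoint A B) :
    ∃ r : K →ₗ[R] A, (∀ (a : A) (ha : (a : G) ∈ K), r ⟨a, ha⟩ = a) ∧
      ∀ x, r x = 0 ↔ (x : G) ∈ B := by
  have hA : A ≤ K := hK ▸ le_sup_left
  have hB : B ≤ K := hK ▸ le_sup_right
  have hc : IsCompl (A.submoduleOf K) (B.submoduleOf K) := by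
    constructor
    · rw [Submodule.disjoint_def] at h ⊢
      intro x hx hx'
      exact Subtype.ext (h x hx hx')
    · rw [codisjoint_iff, ← Submodule.submoduleOf_sup_of_le hA hB, hK]
      exact Submodule.submoduleOf_self K
  refine ⟨(Submodule.submoduleOfEquivOfLe hA).toLinearMap ∘ₗ
    Submodule.projectionOnto _ _ hc, fun a ha ↦ ?_, fun x ↦ ?_⟩
  · have := Submodule.projectionOnto_apply_left hc (⟨⟨a, ha⟩, a.2⟩ : A.submoduleOf K)
    rw [LinearMap.comp_apply, this]
    rfl
  · simp only [LinearMap.comp_apply, LinearEquiv.coe_coe, LinearEquiv.map_eq_zero_iff,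
      Submodule.projectionOnto_apply_eq_zero_iff]
    exact Iff.rfl

variable {R : Type} [CommRing R] {I J : Ideal R}

lemma mul_eq_zero_of_disjoint (hdisj : Disjoint I J) {x y : R} (hx : x ∈ I) (hy : y ∈ J) :
    x * y = 0 :=
  Submodule.disjoint_def.1 hdisj _ (I.mul_mem_right y hx) (J.mul_mem_left x hy)

/-- A linear map between free modules sends vectors with entries in `I` to such vectors. -/
lemma apply_mem_pi {ι κ : Type} [Fintype ι] [DecidableEq ι] (g : (ι → R) →ₗ[R] (κ → R))
    {v : ι → R} (hv : ∀ i, v i ∈ I) (j : κ) : g v j ∈ I := by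
  rw [LinearMap.pi_apply_eq_sum_univ g v, Finset.sum_apply]
  exact I.sum_mem fun i _ ↦ I.mul_mem_right _ (hv i)

variable [IsLocalRing R]

/-- If `𝔪 = I ⊕ J` and `X ≠ 0` is killed by `J`, then `J` is a direct summand of the first syzygy
of `X`. -/
lemma subsingleton_ext_of_annihilates (hsup : J ⊔ I = maximalIdeal R) (hdisj : Disjoint J I)
    {X : Type} [AddCommGroup X] [Module R X] [Module.Finite R X] [Nontrivial X]
    (hX : ∀ j ∈ J, ∀ x : X, j • x = 0) {N : ModuleCat.{0} R} {n : ℕ}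
    (h : Subsingleton (Abelian.Ext (ModuleCat.of R X) N (n + 2))) :
    Subsingleton (Abelian.Ext (ModuleCat.of R J) N (n + 1)) := by
  obtain ⟨ι, _, _, f, hf, hker⟩ := exists_minimal_cover (R := R) (X := X)
  obtain ⟨i₀⟩ : Nonempty ι := by
    by_contra! hι
    exact not_subsingleton X hf.subsingleton
  obtain ⟨r, hr, -⟩ := exists_retraction_of_disjoint hsup hdisj
  have hK := subsingleton_ext_sub (f.ker.injective_subtype) hf (f.exact_subtype_ker_map) h
  let c : J →ₗ[R] f.ker := LinearMap.codRestrict f.ker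
    (LinearMap.single R (fun _ : ι ↦ R) i₀ ∘ₗ J.subtype) fun j ↦ by
      have : Pi.single i₀ (j : R) = (j : R) • Pi.single (M := fun _ : ι ↦ R) i₀ 1 := by
        rw [← Pi.single_smul]
        simp
      simp only [LinearMap.comp_apply, LinearMap.mem_ker, Submodule.subtype_apply,
        LinearMap.single_apply]
      rw [this, map_smul, hX _ j.2]
  let p : f.ker →ₗ[R] maximalIdeal R := LinearMap.codRestrict (maximalIdeal R)
    (LinearMap.proj i₀ ∘ₗ f.ker.subtype) fun v ↦ hker v v.2 i₀
  refine subsingleton_ext_of_leftInverse c (r ∘ₗ p) (fun j ↦ ?_) hK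
  have hj : (j : R) ∈ maximalIdeal R := hsup ▸ Submodule.mem_sup_left j.2
  have : p (c j) = ⟨j, hj⟩ := Subtype.ext
    (Pi.single_eq_same (M := fun _ : ι ↦ R) i₀ (j : R))
  rw [LinearMap.comp_apply, this, hr]

/-- If `𝔪 = I ⊕ J`, then the kernel of a minimal map between free modules splits into a part with
entries in `I` and a part with entries in `J`. -/
lemma ker_eq_sup (hsup : I ⊔ J = maximalIdeal R) (hdisj : Disjoint I J)
    {ι κ : Type} [Fintype ι] [DecidableEq ι] (g : (ι → R) →ₗ[R] (κ → R))
    (hg : ∀ v, g v = 0 → ∀ i, v i ∈ maximalIdeal R) :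
    (g.ker ⊓ Submodule.pi Set.univ fun _ ↦ I) ⊔ (g.ker ⊓ Submodule.pi Set.univ fun _ ↦ J) =
      g.ker := by
  refine le_antisymm (sup_le inf_le_left inf_le_left) fun v hv ↦ ?_
  have hvm := hg v hv
  simp only [← hsup, Submodule.mem_sup] at hvm
  choose y hy z hz hyz using hvm
  have hv' : y + z = v := funext hyz
  have hsum : g y + g z = 0 := by rw [← map_add, hv']; exact hv
  have hgy : g y = 0 := by
    ext j
    refine Submodule.disjoint_def.1 hdisj _ (apply_mem_pi g hy j) ?_
    rw [eq_neg_of_add_eq_zero_left hsum]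
    exact J.neg_mem (apply_mem_pi g hz j)
  have hgz : g z = 0 := by simpa [hgy] using hsum
  exact Submodule.mem_sup.2 ⟨y, ⟨hgy, fun i _ ↦ hy i⟩, z, ⟨hgz, fun i _ ↦ hz i⟩, hv'⟩

variable [IsNoetherianRing R]

/-- The vanishing of `Ext` at the kernel of a minimal map between free modules passes to the part
of the kernel with entries in `I`, and then to `J` if this part is nonzero. -/
lemma subsingleton_ext_of_ker (hsup : I ⊔ J = maximalIdeal R) (hdisj : Disjoint I J)
    {ι κ : Type} [Fintype ι] [DecidableEq ι] (g : (ι → R) →ₗ[R] (κ → R))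
    (hg : ∀ v, g v = 0 → ∀ i, v i ∈ maximalIdeal R)
    (hne : (g.ker ⊓ Submodule.pi Set.univ fun _ ↦ I) ≠ ⊥) {N : ModuleCat.{0} R} {n : ℕ}
    (h : Subsingleton (Abelian.Ext (ModuleCat.of R g.ker) N (n + 2))) :
    Subsingleton (Abelian.Ext (ModuleCat.of R J) N (n + 1)) := by
  have hd : Disjoint (g.ker ⊓ Submodule.pi Set.univ fun _ ↦ I)
      (g.ker ⊓ Submodule.pi Set.univ fun _ ↦ J) := by
    rw [Submodule.disjoint_def]
    exact fun v hv hv' ↦ funext fun i ↦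
      Submodule.disjoint_def.1 hdisj _ (hv.2 i trivial) (hv'.2 i trivial)
  obtain ⟨r, hr, -⟩ := exists_retraction_of_disjoint (ker_eq_sup hsup hdisj g hg) hd
  have := Submodule.nontrivial_iff_ne_bot.2 hne
  refine subsingleton_ext_of_annihilates (sup_comm I J ▸ hsup) hdisj.symm (fun j hj v ↦ ?_)
    (subsingleton_ext_of_leftInverse (Submodule.inclusion inf_le_left) r (fun a ↦ hr a _) h)
  ext i
  exact mul_eq_zero_of_disjoint hdisj.symm hj (v.2.2 i trivial)

/-- If `𝔪 = I ⊕ J` and `X` has projective dimension at least two, then eventual vanishing of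
`Ext^i(X, N)` forces that of `Ext^i(I, N)` or `Ext^i(J, N)`. -/
lemma hasProjectiveDimensionLT_two_or (hsup : I ⊔ J = maximalIdeal R) (hdisj : Disjoint I J)
    (X : Type) [AddCommGroup X] [Module R X] [Module.Finite R X] {N : ModuleCat.{0} R} {n : ℕ}
    (h : ∀ i ≥ n, Subsingleton (Abelian.Ext (ModuleCat.of R X) N (i + 4))) :
    HasProjectiveDimensionLT (ModuleCat.of R X) 2 ∨
      (∀ i ≥ n, Subsingleton (Abelian.Ext (ModuleCat.of R I) N (i + 1))) ∨
      (∀ i ≥ n, Subsingleton (Abelian.Ext (ModuleCat.of R J) N (i + 1))) := by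
  obtain ⟨κ, _, _, f, hf, -⟩ := exists_minimal_cover (R := R) (X := X)
  obtain ⟨ι, _, _, g, hg, hgm⟩ := exists_minimal_cover (R := R) (X := f.ker)
  have hK : ∀ i ≥ n, Subsingleton (Abelian.Ext (ModuleCat.of R g.ker) N (i + 2)) := fun i hi ↦
    subsingleton_ext_sub g.ker.injective_subtype hg g.exact_subtype_ker_map
      (subsingleton_ext_sub f.ker.injective_subtype hf f.exact_subtype_ker_map (h i hi))
  let g' : (ι → R) →ₗ[R] (κ → R) := f.ker.subtype ∘ₗ g
  have hker : g'.ker = g.ker := LinearMap.ker_comp_of_ker_eq_bot g (Submodule.ker_subtype _)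
  have hgm' : ∀ v, g' v = 0 → ∀ i, v i ∈ maximalIdeal R := fun v hv ↦
    hgm v (Subtype.ext hv)
  rw [← hker] at hK
  by_cases hI : (g'.ker ⊓ Submodule.pi Set.univ fun _ ↦ I) = ⊥
  · by_cases hJ : (g'.ker ⊓ Submodule.pi Set.univ fun _ ↦ J) = ⊥
    · left
      have hbot : g.ker = ⊥ := by
        rw [← hker, ← ker_eq_sup hsup hdisj g' hgm', hI, hJ, sup_bot_eq]
      have hS := LinearMap.shortExact_shortComplexKer hf
      have hproj : Projective f.shortComplexKer.X₁ := by
        have : Module.Projective R f.ker := Module.Projective.of_equiv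
          (LinearEquiv.ofBijective g ⟨LinearMap.ker_eq_bot.1 hbot, hg⟩)
        exact inferInstanceAs (Projective (ModuleCat.of R f.ker))
      have hproj' : Projective f.shortComplexKer.X₂ :=
        inferInstanceAs (Projective (ModuleCat.of R (κ → R)))
      exact hS.hasProjectiveDimensionLT_X₃ 1 inferInstance inferInstance
    · exact Or.inr (Or.inl fun i hi ↦ subsingleton_ext_of_ker (sup_comm I J ▸ hsup) hdisj.symm
        g' hgm' hJ (hK i hi))
  · exact Or.inr (Or.inr fun i hi ↦ subsingleton_ext_of_ker hsup hdisj g' hgm' hI (hK i hi))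

/-- If `𝔪 = I ⊕ J` with `I, J ≠ 0`, then eventual vanishing of `Ext^i(I, N)` forces the vanishing
of `Ext^i(𝔪, N)` in all positive degrees. -/
lemma subsingleton_ext_maximalIdeal (hsup : I ⊔ J = maximalIdeal R) (hdisj : Disjoint I J)
    (hI : I ≠ ⊥) (hJ : J ≠ ⊥) {N : ModuleCat.{0} R} {n : ℕ}
    (h : ∀ i ≥ n, Subsingleton (Abelian.Ext (ModuleCat.of R I) N (i + 1))) (i : ℕ) :
    Subsingleton (Abelian.Ext (ModuleCat.of R (maximalIdeal R)) N (i + 1)) := by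
  have := Submodule.nontrivial_iff_ne_bot.2 hI
  have := Submodule.nontrivial_iff_ne_bot.2 hJ
  have hIJ (m : ℕ) (hm : Subsingleton (Abelian.Ext (ModuleCat.of R I) N (m + 2))) :
      Subsingleton (Abelian.Ext (ModuleCat.of R J) N (m + 1)) :=
    subsingleton_ext_of_annihilates (sup_comm I J ▸ hsup) hdisj.symm (fun j hj x ↦
      Subtype.ext (mul_eq_zero_of_disjoint hdisj.symm hj x.2)) hm
  have hJI (m : ℕ) (hm : Subsingleton (Abelian.Ext (ModuleCat.of R J) N (m + 2))) :
      Subsingleton (Abelian.Ext (ModuleCat.of R I) N (m + 1)) :=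
    subsingleton_ext_of_annihilates hsup hdisj (fun j hj x ↦
      Subtype.ext (mul_eq_zero_of_disjoint hdisj hj x.2)) hm
  have hdown : ∀ d m, n ≤ m + d →
      Subsingleton (Abelian.Ext (ModuleCat.of R I) N (m + 1)) ∧
      Subsingleton (Abelian.Ext (ModuleCat.of R J) N (m + 1)) := by
    intro d
    induction d with
    | zero => exact fun m hm ↦ ⟨h m hm, hIJ m (h (m + 1) (by lia))⟩
    | succ d ih =>
      intro m hm
      obtain ⟨h₁, h₂⟩ := ih (m + 1) (by lia)
      exact ⟨hJI m h₂, hIJ m h₁⟩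
  obtain ⟨h₁, h₂⟩ := hdown n i (by lia)
  obtain ⟨r, hr, hr0⟩ := exists_retraction_of_disjoint hsup hdisj
  have hIm : I ≤ maximalIdeal R := hsup ▸ le_sup_left
  have hJm : J ≤ maximalIdeal R := hsup ▸ le_sup_right
  refine subsingleton_ext_mid (f := Submodule.inclusion hJm) (g := r)
    (Submodule.inclusion_injective hJm) (fun a : I ↦ ⟨⟨(a : R), hIm a.2⟩, hr a _⟩)
    (fun x ↦ ?_) h₂ h₁
  rw [hr0]
  exact ⟨fun hx ↦ ⟨⟨x, hx⟩, rfl⟩, by rintro ⟨y, rfl⟩; exact y.2⟩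

/-- If `𝔪 = I ⊕ J` with `I, J ≠ 0`, then eventual vanishing of `Ext^i(I, N)` forces `N` to have
injective dimension at most one. -/
lemma hasInjectiveDimensionLT_two (hsup : I ⊔ J = maximalIdeal R) (hdisj : Disjoint I J)
    (hI : I ≠ ⊥) (hJ : J ≠ ⊥) {N : ModuleCat.{0} R} [Module.Finite R N] {n : ℕ}
    (h : ∀ i ≥ n, Subsingleton (Abelian.Ext (ModuleCat.of R I) N (i + 1))) :
    HasInjectiveDimensionLT N 2 := by
  have hk : ∀ i ≥ 2, Subsingleton
      (Abelian.Ext (ModuleCat.of R (R ⧸ maximalIdeal R)) N i) := by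
    intro i hi
    obtain ⟨i, rfl⟩ := Nat.exists_eq_add_of_le' hi
    exact subsingleton_ext_succ_quotient (maximalIdeal R).injective_subtype
      (maximalIdeal R).mkQ_surjective (LinearMap.exact_subtype_mkQ _)
      (subsingleton_ext_maximalIdeal hsup hdisj hI hJ h i)
  exact hasInjectiveDimensionLT_two_of_quotient N fun a ↦
    subsingleton_ext_quotient N 2 hk a 2 le_rfl

/-- The main dichotomy for a local ring whose maximal ideal is the direct sum of two nonzero
ideals. -/
theorem hasProjectiveDimensionLT_two_or_hasInjectiveDimensionLT_two
    (hsup : I ⊔ J = maximalIdeal R) (hdisj : Disjoint I J) (hI : I ≠ ⊥) (hJ : J ≠ ⊥)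
    (X : Type) [AddCommGroup X] [Module R X] [Module.Finite R X]
    (N : ModuleCat.{0} R) [Module.Finite R N] {n : ℕ}
    (h : ∀ i ≥ n, Subsingleton (Abelian.Ext (ModuleCat.of R X) N (i + 1))) :
    HasProjectiveDimensionLT (ModuleCat.of R X) 2 ∨ HasInjectiveDimensionLT N 2 := by
  rcases hasProjectiveDimensionLT_two_or hsup hdisj X (N := N) (n := n)
    (fun i hi ↦ h (i + 3) (by lia)) with hX | hN | hN
  · exact Or.inl hX
  · exact Or.inr (hasInjectiveDimensionLT_two hsup hdisj hI hJ hN)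
  · exact Or.inr (hasInjectiveDimensionLT_two (sup_comm I J ▸ hsup) hdisj.symm hJ hI hN)

end DecomposableMaximalIdeal

section FiberProduct

variable {S T k : Type} [CommRing S] [CommRing T] [Field k] {πS : S →+* k} {πT : T →+* k}

lemma ρS_surjective (hπT : Function.Surjective πT) : Function.Surjective (ρS πS πT) := by
  intro s
  obtain ⟨t, ht⟩ := hπT (πS s)
  exact ⟨⟨(s, t), ht.symm⟩, rfl⟩

lemma ρT_surjective (hπS : Function.Surjective πS) : Function.Surjective (ρT πS πT) := by
  intro t
  obtain ⟨s, hs⟩ := hπS (πT t)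
  exact ⟨⟨(s, t), hs⟩, rfl⟩

lemma fiberProd_isNoetherianRing [IsNoetherianRing S] [IsNoetherianRing T]
    (hπS : Function.Surjective πS) (hπT : Function.Surjective πT) :
    IsNoetherianRing (fiberProd πS πT) := by
  algebraize [ρS πS πT, ρT πS πT]
  have : RingHomSurjective (ρS πS πT) := ⟨ρS_surjective hπT⟩
  have : RingHomSurjective (ρT πS πT) := ⟨ρT_surjective hπS⟩
  have : IsNoetherian (fiberProd πS πT) S :=
    (LinearMap.isNoetherian_iff_of_bijective
      (⟨AddHom.id S, fun _ _ ↦ rfl⟩ : S →ₛₗ[ρS πS πT] S) Function.bijective_id).2 inferInstance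
  have : IsNoetherian (fiberProd πS πT) T :=
    (LinearMap.isNoetherian_iff_of_bijective
      (⟨AddHom.id T, fun _ _ ↦ rfl⟩ : T →ₛₗ[ρT πS πT] T) Function.bijective_id).2 inferInstance
  exact isNoetherian_of_injective
    ((Algebra.linearMap (fiberProd πS πT) S).prod (Algebra.linearMap (fiberProd πS πT) T))
    fun _ _ h ↦ Subtype.ext h

lemma disjoint_ker_ρT_ker_ρS :
    Disjoint (RingHom.ker (ρT πS πT)) (RingHom.ker (ρS πS πT)) := by
  rw [Submodule.disjoint_def]
  exact fun x hx hx' ↦ Subtype.ext (Prod.ext hx' hx)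

lemma ker_ρT_ne_bot [IsLocalRing S] (hkS : RingHom.ker πS = maximalIdeal S)
    (hS : maximalIdeal S ≠ ⊥) :
    RingHom.ker (ρT πS πT) ≠ ⊥ := by
  obtain ⟨s, hs, hs0⟩ := Submodule.exists_mem_ne_zero_of_ne_bot hS
  rw [← hkS] at hs
  refine (Submodule.ne_bot_iff _).2
    ⟨⟨(s, 0), Eq.trans hs (map_zero πT).symm⟩, rfl, fun h ↦ hs0 ?_⟩
  exact congrArg (fun x : fiberProd πS πT ↦ (x : S × T).1) h

lemma ker_ρS_ne_bot [IsLocalRing T] (hkT : RingHom.ker πT = maximalIdeal T)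
    (hT : maximalIdeal T ≠ ⊥) :
    RingHom.ker (ρS πS πT) ≠ ⊥ := by
  obtain ⟨t, ht, ht0⟩ := Submodule.exists_mem_ne_zero_of_ne_bot hT
  rw [← hkT] at ht
  refine (Submodule.ne_bot_iff _).2
    ⟨⟨(0, t), Eq.trans (map_zero πS) (Eq.symm ht)⟩, rfl, fun h ↦ ht0 ?_⟩
  exact congrArg (fun x : fiberProd πS πT ↦ (x : S × T).2) h

lemma fiberProd_isLocalRing [IsLocalRing S] [IsLocalRing T] (hπT : Function.Surjective πT) :
    IsLocalRing (fiberProd πS πT) :=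
  have := hπT.isLocalHom
  RingHom.isLocalRing_pullback πS πT

variable [IsLocalRing S] [IsLocalRing T] [IsLocalRing (fiberProd πS πT)]

lemma mem_maximalIdeal_fiberProd_iff (hπT : Function.Surjective πT) (x : fiberProd πS πT) :
    x ∈ maximalIdeal (fiberProd πS πT) ↔ (x : S × T).1 ∈ maximalIdeal S := by
  have := hπT.isLocalHom
  have : IsLocalHom (ρS πS πT) := RingHom.isLocalHom_pullbackFst πS πT
  simp only [mem_maximalIdeal, mem_nonunits_iff]
  exact not_congr (isUnit_map_iff (ρS πS πT) x).symm

/-- The maximal ideal of the fiber product is the direct sum of those of the factors. -/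
lemma ker_ρT_sup_ker_ρS (hπT : Function.Surjective πT)
    (hkS : RingHom.ker πS = maximalIdeal S) :
    RingHom.ker (ρT πS πT) ⊔ RingHom.ker (ρS πS πT) = maximalIdeal (fiberProd πS πT) := by
  refine le_antisymm (sup_le (le_maximalIdeal (RingHom.ker_ne_top _))
    (le_maximalIdeal (RingHom.ker_ne_top _))) fun x hx ↦ ?_
  obtain ⟨⟨s, t⟩, hst⟩ := x
  rw [mem_maximalIdeal_fiberProd_iff hπT, ← hkS] at hx
  have hs : πS s = 0 := hx
  have ht : πT t = 0 := hst.symm.trans hs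
  exact Submodule.mem_sup.2 ⟨⟨(s, 0), hs.trans (map_zero πT).symm⟩, rfl,
    ⟨(0, t), (map_zero πS).trans ht.symm⟩, rfl, Subtype.ext (by simp)⟩

end FiberProduct

/-- Corollary 4.2: over the fiber product `R = S ×ₖ T`, if `Ext^i_R(M,N) = 0` for all
`i ≫ 0`, then `pd_R M ≤ 1` or `id_R N ≤ 1`. -/
theorem stmt_14 (S T k : Type) [CommRing S] [CommRing T] [Field k]
    [IsNoetherianRing S] [IsNoetherianRing T] [IsLocalRing S] [IsLocalRing T]
    (πS : S →+* k) (πT : T →+* k)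
    (hπS : Function.Surjective πS) (hπT : Function.Surjective πT)
    (hkS : RingHom.ker πS = maximalIdeal S) (hkT : RingHom.ker πT = maximalIdeal T)
    (hS : maximalIdeal S ≠ ⊥) (hT : maximalIdeal T ≠ ⊥)
    (M N : Type) [AddCommGroup M] [Module ↥(fiberProd πS πT) M]
    [Module.Finite ↥(fiberProd πS πT) M]
    [AddCommGroup N] [Module ↥(fiberProd πS πT) N]
    [Module.Finite ↥(fiberProd πS πT) N]
    (hvan : ∃ n : ℕ, ∀ i ≥ n, ExtZero ↥(fiberProd πS πT) M N i) :
    PdLE ↥(fiberProd πS πT) M 1 ∨ IdLE ↥(fiberProd πS πT) N 1 := by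
  have := fiberProd_isNoetherianRing hπS hπT
  have := fiberProd_isLocalRing (πS := πS) hπT
  obtain ⟨n, hn⟩ := hvan
  refine (hasProjectiveDimensionLT_two_or_hasInjectiveDimensionLT_two
    (ker_ρT_sup_ker_ρS hπT hkS) disjoint_ker_ρT_ker_ρS (ker_ρT_ne_bot hkS hS)
    (ker_ρS_ne_bot hkT hT) M (ModuleCat.of _ N) (n := n) fun i hi ↦
      (subsingleton_ext_succ_iff _ _ i).1 (hn (i + 1) (by lia))).imp ?_ ?_
  · intro _ Y i hi
    obtain ⟨j, rfl⟩ := Nat.exists_eq_add_of_lt hi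
    exact (subsingleton_ext_succ_iff _ _ _).2
      (HasProjectiveDimensionLT.subsingleton _ 2 _ (by lia) Y)
  · intro _ X i hi
    obtain ⟨j, rfl⟩ := Nat.exists_eq_add_of_lt hi
    exact (subsingleton_ext_succ_iff _ _ _).2
      (HasInjectiveDimensionLT.subsingleton _ 2 _ (by lia) X)
end
end
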